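/- Inverse weight transition through a three-dimensional saddle, first case: with the vector field ξ, the cylinder B, the map φ_x, the fence Φ and the saturation as in the context, let D' ⊆ (0,1) × (0,1) be a subset of weight ρ'' > 0 at the origin and let S'_y be the saturation of Φ(D') by the ξ-flow in B. Then the set φ_x⁻¹(S'_y) = {(u,v) ∈ ℝ²_{>0} : (1,u,v) ∈ S'_y} has weight (1 + μρ'')/(λρ'') at the origin. -/

import Mathlib

open Filter Set

/-- A parameterized real analytic curve `c : [1,∞) → ℝ²_{>0}` with nonvanishing
derivative for `t > 1` and limit `(0,0)` at infinity. -/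
def WeightCurve (c : ℝ → ℝ × ℝ) : Prop :=
  AnalyticOnNhd ℝ c (Set.Ici 1) ∧
  (∀ t ∈ Set.Ici (1 : ℝ), 0 < (c t).1 ∧ 0 < (c t).2) ∧
  (∀ t : ℝ, 1 < t → deriv c t ≠ 0) ∧
  Tendsto c atTop (nhds (0, 0))

/-- The curve `c` has weight `ρ` at the origin:
`k₁·c₁(t)^ρ < c₂(t) < k₂·c₁(t)^ρ` for all `t > t₀`. -/
def CurveHasWeight (c : ℝ → ℝ × ℝ) (ρ : ℝ) : Prop :=
  ∃ k₁ k₂ t₀ : ℝ, 0 < k₁ ∧ k₁ < k₂ ∧ 1 < t₀ ∧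
    ∀ t : ℝ, t₀ < t → k₁ * (c t).1 ^ ρ < (c t).2 ∧ (c t).2 < k₂ * (c t).1 ^ ρ

/-- A subset `C ⊆ ℝ²_{>0}` has weight `ρ` if it is the image of a parameterized
real analytic curve of weight `ρ`. -/
def SetHasWeight (C : Set (ℝ × ℝ)) (ρ : ℝ) : Prop :=
  ∃ c : ℝ → ℝ × ℝ, WeightCurve c ∧ CurveHasWeight c ρ ∧ C = c '' Set.Ici 1

/-- The cylinder `B = {0 ≤ x ≤ 1, 0 ≤ y, 0 ≤ z, y² + z² ≤ 1}` in `ℝ³`. -/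
def Bcyl : Set (ℝ × ℝ × ℝ) :=
  {p | 0 ≤ p.1 ∧ p.1 ≤ 1 ∧ 0 ≤ p.2.1 ∧ 0 ≤ p.2.2 ∧ p.2.1 ^ 2 + p.2.2 ^ 2 ≤ 1}

/-- The saturation of `A` by the `ξ`-flow in `B`: points lying on an integral curve
of `ξ` contained in `B` that starts or ends in `A`. -/
def Saturation (ξ : ℝ × ℝ × ℝ → ℝ × ℝ × ℝ) (A : Set (ℝ × ℝ × ℝ)) : Set (ℝ × ℝ × ℝ) :=
  {p | ∃ s₀ s₁ : ℝ, s₀ ≤ s₁ ∧ ∃ γ : ℝ → ℝ × ℝ × ℝ,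
    (∀ τ ∈ Set.Icc s₀ s₁, γ τ ∈ Bcyl) ∧
    (∀ τ ∈ Set.Icc s₀ s₁, HasDerivAt γ (ξ (γ τ)) τ) ∧
    (∃ s ∈ Set.Icc s₀ s₁, γ s = p) ∧
    (γ s₀ ∈ A ∨ γ s₁ ∈ A)}

/-- The inclusion `φ_x(u,v) = (1,u,v)`. -/
def phiX (q : ℝ × ℝ) : ℝ × ℝ × ℝ := (1, q.1, q.2)

/-- The fence `Φ(u,v) = (v, cos(πu/2), sin(πu/2))`. -/
noncomputable def fencePhi (q : ℝ × ℝ) : ℝ × ℝ × ℝ :=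
  (q.2, Real.cos (Real.pi * q.1 / 2), Real.sin (Real.pi * q.1 / 2))

/-- The fence `Φ̄(u,v) = (v, sin(πu/2), cos(πu/2))`. -/
noncomputable def fencePhiBar (q : ℝ × ℝ) : ℝ × ℝ × ℝ :=
  (q.2, Real.sin (Real.pi * q.1 / 2), Real.cos (Real.pi * q.1 / 2))

/-- The domain `[0,1] × [0,1]` of the fences. -/
def fenceSquare : Set (ℝ × ℝ) := Set.Icc (0 : ℝ) 1 ×ˢ Set.Icc (0 : ℝ) 1

section Nemytskii

theorem ContinuousMap.update_apply_eq {T E : Type*} [TopologicalSpace T] [NormedAddCommGroup E]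
    {n : ℕ} [DecidableEq (Fin n)] (m : Fin n → C(T, E))
    (i : Fin n) (z : C(T, E)) (s : T) :
    (fun j => Function.update m i z j s) = Function.update (fun j => m j s) i (z s) := by
  ext j
  by_cases h : j = i
  · subst h; simp
  · simp [h]

variable {T E F : Type*} [TopologicalSpace T] [CompactSpace T]
  [NormedAddCommGroup E] [NormedSpace ℝ E] [NormedAddCommGroup F] [NormedSpace ℝ F]

variable (T) in
/-- A continuous multilinear map acting pointwise on continuous maps. -/
noncomputable def ContinuousMultilinearMap.pointwise {n : ℕ} (p : E [×n]→L[ℝ] F) :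
    C(T, E) [×n]→L[ℝ] C(T, F) :=
  MultilinearMap.mkContinuous
    { toFun := fun h => ⟨fun s => p fun i => h i s, by fun_prop⟩
      map_update_add' := by
        intro _ m i x y
        ext s
        simp only [ContinuousMap.coe_mk, ContinuousMap.add_apply, ContinuousMap.update_apply_eq]
        exact p.map_update_add _ _ _ _
      map_update_smul' := by
        intro _ m i c x
        ext s
        simp only [ContinuousMap.coe_mk, ContinuousMap.smul_apply, ContinuousMap.update_apply_eq]
        exact p.map_update_smul _ _ _ _ }
    ‖p‖ fun m => by
      rw [ContinuousMap.norm_le _ (by positivity)]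
      intro s
      exact (p.le_opNorm _).trans (mul_le_mul_of_nonneg_left
        (Finset.prod_le_prod (fun _ _ => norm_nonneg _) fun i _ => (m i).norm_coe_le_norm s)
        (norm_nonneg _))

@[simp]
theorem ContinuousMultilinearMap.pointwise_apply {n : ℕ} (p : E [×n]→L[ℝ] F)
    (h : Fin n → C(T, E)) (s : T) : p.pointwise T h s = p fun i => h i s := rfl

theorem ContinuousMultilinearMap.norm_pointwise_le {n : ℕ} (p : E [×n]→L[ℝ] F) :
    ‖p.pointwise T‖ ≤ ‖p‖ :=
  MultilinearMap.mkContinuous_norm_le _ (norm_nonneg _) _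

/-- Post-composition with a map analytic at `p` is analytic at the constant map `p`. -/
theorem analyticAt_continuousMap_comp_const [CompleteSpace F] (f : C(E, F)) {p : E}
    (hf : AnalyticAt ℝ f p) :
    AnalyticAt ℝ (fun γ : C(T, E) => f.comp γ) (ContinuousMap.const T p) := by
  obtain ⟨P, r, hP⟩ := hf
  let Q : FormalMultilinearSeries ℝ C(T, E) C(T, F) := fun n => (P n).pointwise T
  have hQ : P.radius ≤ Q.radius := by
    refine ENNReal.le_of_forall_nnreal_lt fun s hs => ?_
    obtain ⟨C, -, hC⟩ := P.norm_mul_pow_le_of_lt_radius hs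
    exact Q.le_radius_of_bound C fun n =>
      (mul_le_mul_of_nonneg_right (P n).norm_pointwise_le (by positivity)).trans (hC n)
  refine ⟨Q, r, hP.r_le.trans hQ, hP.r_pos, fun {y} hy => ?_⟩
  have hsum : Summable fun n => Q n fun _ => y :=
    (Q.summable_norm_apply (Metric.eball_subset_eball (hP.r_le.trans hQ) hy)).of_norm
  obtain ⟨S, hS⟩ := hsum
  suffices S = f.comp (ContinuousMap.const T p + y) by rwa [← this]
  ext s
  have h1 : HasSum (fun n => P n fun _ => y s) (S s) := by
    simpa [Q] using hS.mapL (ContinuousMap.evalCLM ℝ s)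
  have hys : y s ∈ Metric.eball (0 : E) r := by
    simp only [Metric.mem_eball, edist_zero_right] at hy ⊢
    refine lt_of_le_of_lt ?_ hy
    simpa [enorm_le_iff_norm_le] using y.norm_coe_le_norm s
  exact h1.unique (hP.hasSum hys)

end Nemytskii

section Flow

open Topology ContDiff

variable {E : Type*} [NormedAddCommGroup E] [NormedSpace ℝ E]

/-- `W` is the global flow of the autonomous vector field `K`. -/
def IsFlow (K : E → E) (W : E → ℝ → E) : Prop :=
  ∀ p, W p 0 = p ∧ ∀ s, HasDerivAt (W p) (K (W p s)) s

theorem exists_isFlow [CompleteSpace E] {K : E → E} {C : NNReal} (hK : LipschitzWith C K) {M : ℝ}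
    (hM : ∀ p, ‖K p‖ ≤ M) : ∃ W, IsFlow K W := by
  lift M to NNReal using (norm_nonneg _).trans (hM 0)
  have hex : ∀ (p : E) (n : ℕ), ∃ α : ℝ → E, α 0 = p ∧
      ∀ s ∈ Ioo (-(n + 1) : ℝ) (n + 1), HasDerivAt α (K (α s)) s := by
    intro p n
    have h0 : (0 : ℝ) ∈ Icc (-(n + 1) : ℝ) (n + 1) := ⟨by linarith, by linarith⟩
    have hPL : IsPicardLindelof (fun _ => K) (⟨0, h0⟩ : Icc (-(n + 1) : ℝ) (n + 1)) p
        (M * (n + 1)) 0 M C :=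
      { lipschitzOnWith := fun _ _ => hK.lipschitzOnWith
        continuousOn := fun _ _ => continuousOn_const
        norm_le := fun _ _ x _ => hM x
        mul_max_le := by simp }
    obtain ⟨α, h1, h2⟩ := hPL.exists_eq_forall_mem_Icc_hasDerivWithinAt₀
    exact ⟨α, h1, fun s hs => (h2 s (Ioo_subset_Icc_self hs)).hasDerivAt (Icc_mem_nhds hs.1 hs.2)⟩
  choose α h0 hα using hex
  have hagree : ∀ p n m, n ≤ m → EqOn (α p n) (α p m) (Ioo (-(n + 1) : ℝ) (n + 1)) := by
    intro p n m hnm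
    have hnm' : (n : ℝ) ≤ m := by exact_mod_cast hnm
    refine ODE_solution_unique_of_mem_Ioo (v := fun _ => K) (s := fun _ => univ) (t₀ := 0)
      (fun _ _ => hK.lipschitzOnWith) ⟨by linarith, by linarith⟩
      (fun s hs => ⟨hα p n s hs, trivial⟩)
      (fun s hs => ⟨hα p m s ⟨by linarith [hs.1], by linarith [hs.2]⟩, trivial⟩) ?_
    rw [h0, h0]
  refine ⟨fun p s => α p ⌈|s|⌉₊ s, fun p => ⟨h0 _ _, fun s => ?_⟩⟩
  set n := ⌈|s|⌉₊ with hn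
  have hsn : |s| < n + 1 := (Nat.le_ceil _).trans_lt (lt_add_one _)
  have hs : s ∈ Ioo (-(n + 1) : ℝ) (n + 1) := abs_lt.mp hsn
  refine (hα p n s hs).congr_of_eventuallyEq ?_
  filter_upwards [Ioo_mem_nhds hs.1 hs.2] with r hr
  have hrI : r ∈ Ioo (-(⌈|r|⌉₊ + 1) : ℝ) (⌈|r|⌉₊ + 1) :=
    abs_lt.mp ((Nat.le_ceil _).trans_lt (lt_add_one _))
  rcases le_total n ⌈|r|⌉₊ with h | h
  · exact (hagree p _ _ h hr).symm
  · exact hagree p _ _ h hrI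

/-- The integration operator `γ ↦ (s ↦ ∫₀ˢ γ)` on continuous curves parameterized by `[0,1]`. -/
noncomputable def integrationCLM (E : Type*) [NormedAddCommGroup E] [NormedSpace ℝ E] :
    C(unitInterval, E) →L[ℝ] C(unitInterval, E) :=
  LinearMap.mkContinuous
    { toFun := fun γ => ⟨fun s => ∫ r in (0 : ℝ)..s, γ (projIcc 0 1 zero_le_one r),
        (intervalIntegral.continuous_primitive (fun _ _ => Continuous.intervalIntegrable
          (γ.continuous.comp continuous_projIcc) _ _) 0).comp continuous_subtype_val⟩
      map_add' := fun γ δ => by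
        ext s
        exact intervalIntegral.integral_add
          (Continuous.intervalIntegrable (γ.continuous.comp continuous_projIcc) _ _)
          (Continuous.intervalIntegrable (δ.continuous.comp continuous_projIcc) _ _)
      map_smul' := fun c γ => by
        ext s
        exact intervalIntegral.integral_smul _ _ }
    1 fun γ => by
      rw [ContinuousMap.norm_le _ (by positivity)]
      intro s
      refine (intervalIntegral.norm_integral_le_of_norm_le_const
        (fun r _ => γ.norm_coe_le_norm (projIcc 0 1 zero_le_one r))).trans ?_
      have : |(s : ℝ) - 0| ≤ 1 := by
        rw [sub_zero, abs_of_nonneg s.2.1]; exact s.2.2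
      nlinarith [norm_nonneg γ]

theorem integrationCLM_apply (γ : C(unitInterval, E)) (s : unitInterval) :
    integrationCLM E γ s = ∫ r in (0 : ℝ)..s, γ (projIcc 0 1 zero_le_one r) := rfl

namespace IsFlow

variable {K : E → E} {W : E → ℝ → E} {C : NNReal}

theorem continuous (hW : IsFlow K W) (p : E) : Continuous (W p) :=
  continuous_iff_continuousAt.mpr fun s => ((hW p).2 s).continuousAt

theorem eq_of_hasDerivAt (hW : IsFlow K W) (hK : LipschitzWith C K) {α : ℝ → E}
    (hα : ∀ s, HasDerivAt α (K (α s)) s) (s : ℝ) : α s = W (α 0) s := by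
  have : α = W (α 0) := ODE_solution_unique_univ (v := fun _ => K) (s := fun _ => univ) (t₀ := 0)
    (fun _ => hK.lipschitzOnWith) (fun s => ⟨hα s, trivial⟩)
    (fun s => ⟨(hW _).2 s, trivial⟩) (hW _).1.symm
  exact congrFun this s

theorem add (hW : IsFlow K W) (hK : LipschitzWith C K) (p : E) (s r : ℝ) :
    W p (s + r) = W (W p s) r := by
  have := hW.eq_of_hasDerivAt hK (α := fun r => W p (s + r))
    (fun r => ((hW p).2 (s + r)).comp_const_add s r) r
  simpa using this

/-- A continuous solution of the rescaled integral equation on `[0,1]` is a piece of the flow. -/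
theorem eq_of_integral_eq [CompleteSpace E] (hW : IsFlow K W) (hK : LipschitzWith C K)
    {γ : C(unitInterval, E)} {p : E} {τ : ℝ}
    (hγ : γ = ContinuousMap.const _ p +
      τ • integrationCLM E ((⟨K, hK.continuous⟩ : C(E, E)).comp γ)) :
    γ 1 = W p τ := by
  let g : ℝ → E := fun s => p + τ • ∫ r in (0 : ℝ)..s, K (γ (projIcc 0 1 zero_le_one r))
  have hcont : Continuous fun r => K (γ (projIcc 0 1 zero_le_one r)) :=
    hK.continuous.comp (γ.continuous.comp continuous_projIcc)
  have hg : ∀ s : unitInterval, γ s = g s := fun s => by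
    conv_lhs => rw [hγ]
    simp [g, integrationCLM_apply]
  have hg' : ∀ s ∈ Icc (0 : ℝ) 1, HasDerivAt g (τ • K (g s)) s := by
    intro s hs
    have h1 := ((intervalIntegral.integral_hasDerivAt_right
      (hcont.intervalIntegrable 0 s) (hcont.stronglyMeasurableAtFilter _ _)
      hcont.continuousAt).const_smul τ).const_add p
    rw [projIcc_of_mem _ hs, hg] at h1
    exact h1
  have h2 : EqOn g (fun s => W p (s * τ)) (Icc 0 1) := by
    refine ODE_solution_unique (v := fun _ q => τ • K q) (K := ‖τ‖₊ * C)
      (fun _ => (lipschitzWith_smul τ).comp hK)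
      (fun s hs => (hg' s hs).continuousAt.continuousWithinAt)
      (fun s hs => (hg' s (Ico_subset_Icc_self hs)).hasDerivWithinAt)
      ((hW.continuous p).comp (by fun_prop)).continuousOn
      (fun s hs => ?_) (by simp [g, (hW p).1])
    have := HasDerivAt.scomp s ((hW p).2 (s * τ)) ((hasDerivAt_id s).mul_const τ)
    simpa [Function.comp_def] using this.hasDerivWithinAt
  have := h2 (right_mem_Icc.mpr zero_le_one)
  simpa [hg 1] using this

end IsFlow

/-- The inclusion of a normed space into continuous maps as constant maps. -/
noncomputable def constantMapCLM (T E : Type*) [TopologicalSpace T] [CompactSpace T]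
    [NormedAddCommGroup E] [NormedSpace ℝ E] : E →L[ℝ] C(T, E) :=
  LinearMap.mkContinuous
    { toFun := ContinuousMap.const T
      map_add' := fun _ _ => rfl
      map_smul' := fun _ _ => rfl }
    1 fun p => by
      rw [one_mul, ContinuousMap.norm_le _ (norm_nonneg _)]
      exact fun _ => le_rfl

theorem constantMapCLM_apply {T : Type*} [TopologicalSpace T] [CompactSpace T] (p : E) :
    constantMapCLM T E p = ContinuousMap.const T p := rfl

namespace IsFlow

variable {K : E → E} {W : E → ℝ → E} {C : NNReal}

theorem analyticAt_zero [CompleteSpace E] (hW : IsFlow K W) (hK : LipschitzWith C K) {p : E}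
    (hp : AnalyticAt ℝ K p) : AnalyticAt ℝ (fun x : E × ℝ => W x.1 x.2) (p, 0) := by
  let X := C(unitInterval, E)
  let N : X → X := fun γ => (⟨K, hK.continuous⟩ : C(E, E)).comp γ
  let u : (E × ℝ) × X := ((p, 0), ContinuousMap.const _ p)
  let f : (E × ℝ) × X → X := fun x =>
    x.2 - constantMapCLM unitInterval E x.1.1 - x.1.2 • integrationCLM E (N x.2)
  have hN : AnalyticAt ℝ N (ContinuousMap.const _ p) :=
    analyticAt_continuousMap_comp_const (T := unitInterval) (⟨K, hK.continuous⟩ : C(E, E)) hp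
  have hfa : AnalyticAt ℝ f u := by
    have h2 : AnalyticAt ℝ (fun x : (E × ℝ) × X => x.2) u := analyticAt_snd
    have h1 : AnalyticAt ℝ (fun x : (E × ℝ) × X => x.1) u := analyticAt_fst
    have h11 : AnalyticAt ℝ (fun x : (E × ℝ) × X => x.1.1) u :=
      AnalyticAt.comp (g := Prod.fst) analyticAt_fst h1
    have h12 : AnalyticAt ℝ (fun x : (E × ℝ) × X => x.1.2) u :=
      AnalyticAt.comp (g := Prod.snd) analyticAt_snd h1
    have h3 : AnalyticAt ℝ (fun x : (E × ℝ) × X => integrationCLM E (N x.2)) u :=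
      ((integrationCLM E).analyticAt _).comp (AnalyticAt.comp (g := N) hN h2)
    exact (h2.sub (((constantMapCLM unitInterval E).analyticAt _).comp h11)).sub (h12.smul h3)
  have hf : ContDiffAt ℝ ω f u := hfa.contDiffAt
  have hinv : (fderiv ℝ f u ∘L .inr ℝ (E × ℝ) X).IsInvertible := by
    have h1 : HasFDerivAt (fun γ : X => f (u.1, γ)) (fderiv ℝ f u ∘L .inr ℝ (E × ℝ) X) u.2 :=
      HasFDerivAt.comp (g := f) u.2 hfa.differentiableAt.hasFDerivAt (hasFDerivAt_prodMk_right _ _)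
    have h2 : HasFDerivAt (fun γ : X => f (u.1, γ)) (ContinuousLinearMap.id ℝ X) u.2 := by
      simpa [f, u] using
        (hasFDerivAt_id u.2).sub_const (constantMapCLM unitInterval E p)
    rw [h1.unique h2]
    exact ContinuousLinearMap.isInvertible_equiv (f := ContinuousLinearEquiv.refl ℝ X)
  have hfu : f u = 0 := by
    simp [f, u, constantMapCLM_apply]
  have hψ := hf.contDiffAt_implicitFunction (by simp) hinv
  have hev := hf.eventually_apply_implicitFunction (by simp) hinv
  set ψ := hf.implicitFunction (by simp) hinv
  have hψa : AnalyticAt ℝ (fun x => ψ x 1) (p, 0) :=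
    AnalyticAt.comp (g := fun γ : X => γ 1)
      ((ContinuousMap.evalCLM ℝ (1 : unitInterval) : X →L[ℝ] E).analyticAt _) hψ.analyticAt
  refine hψa.congr ?_
  filter_upwards [hev] with x hx
  rw [hfu] at hx
  refine hW.eq_of_integral_eq hK ?_
  have : ψ x - constantMapCLM unitInterval E x.1 - x.2 • integrationCLM E (N (ψ x)) = 0 := hx
  rw [sub_sub, sub_eq_zero] at this
  exact this

/-- The flow is jointly analytic at `(p, s)` as soon as the vector field is analytic along an orbit
segment from `p` that contains time `s`. -/
theorem analyticAt [CompleteSpace E] (hW : IsFlow K W) (hK : LipschitzWith C K) {p : E}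
    {J : Set ℝ} (hJ : IsPreconnected J) (h0 : 0 ∈ J) (hp : ∀ s ∈ J, AnalyticAt ℝ K (W p s))
    {s : ℝ} (hs : s ∈ J) : AnalyticAt ℝ (fun x : E × ℝ => W x.1 x.2) (p, s) := by
  let U : Set ℝ := {r | AnalyticAt ℝ (fun x : E × ℝ => W x.1 x.2) (p, r)}
  have hU : IsOpen U :=
    (isOpen_analyticAt ℝ (fun x : E × ℝ => W x.1 x.2)).preimage (Continuous.prodMk_right p)
  have h0U : (0 : ℝ) ∈ U := hW.analyticAt_zero hK (by simpa [(hW p).1] using hp 0 h0)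
  refine hJ.subset_of_closure_inter_subset hU ⟨0, h0, h0U⟩ ?_ hs
  rintro r ⟨hr, hrJ⟩
  have hloc := (isOpen_analyticAt ℝ (fun x : E × ℝ => W x.1 x.2)).mem_nhds
    (hW.analyticAt_zero hK (hp r hrJ))
  have hc : ContinuousAt (fun r' => (W p r', r - r')) r :=
    ((hW.continuous p).prodMk (by fun_prop)).continuousAt
  have hev : ∀ᶠ r' in 𝓝 r, AnalyticAt ℝ (fun x : E × ℝ => W x.1 x.2) (W p r', r - r') :=
    hc (by simpa using hloc)
  obtain ⟨r', hr', hr'U⟩ := (mem_closure_iff_frequently.mp hr).and_eventually hev |>.exists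
  have h1 : AnalyticAt ℝ (fun x : E × ℝ => W x.1 r') (p, r) :=
    AnalyticAt.comp_of_eq (g := fun x : E × ℝ => W x.1 x.2) (f := fun x : E × ℝ => (x.1, r'))
      hr' (analyticAt_fst.prod analyticAt_const) rfl
  have h2 : AnalyticAt ℝ (fun x : E × ℝ => W (W x.1 r') (x.2 - r')) (p, r) :=
    AnalyticAt.comp_of_eq (g := fun x : E × ℝ => W x.1 x.2)
      (f := fun x : E × ℝ => (W x.1 r', x.2 - r')) hr'U
      (h1.prod (analyticAt_snd.sub analyticAt_const)) rfl
  refine h2.congr (Eventually.of_forall fun x => ?_)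
  simp [← hW.add hK]

end IsFlow
end Flow

section Saddle

open Topology

theorem isCompact_Bcyl : IsCompact Bcyl := by
  refine (isCompact_Icc (a := ((0 : ℝ), (0 : ℝ), (0 : ℝ))) (b := (1, 1, 1))).of_isClosed_subset
    ?_ ?_
  · refine (isClosed_le continuous_const continuous_fst).inter
      ((isClosed_le continuous_fst continuous_const).inter
      ((isClosed_le continuous_const (continuous_fst.comp continuous_snd)).inter
      ((isClosed_le continuous_const (continuous_snd.comp continuous_snd)).inter
      (isClosed_le (f := fun p : ℝ × ℝ × ℝ => p.2.1 ^ 2 + p.2.2 ^ 2) (by fun_prop)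
        continuous_const))))
  · rintro ⟨x, y, z⟩ ⟨h1, h2, h3, h4, h5⟩
    simp only at h1 h2 h3 h4 h5
    refine ⟨⟨h1, h3, h4⟩, ⟨h2, ?_, ?_⟩⟩ <;> simp only <;> nlinarith

/-- A solution of a continuous scalar linear equation with positive initial value is positive. -/
theorem pos_of_hasDerivAt_mul_self {f θ : ℝ → ℝ} (hθ : Continuous θ)
    (hf : ∀ s, HasDerivAt f (θ s * f s) s) (h0 : 0 < f 0) (s : ℝ) : 0 < f s := by
  let Θ : ℝ → ℝ := fun s => ∫ r in (0 : ℝ)..s, θ r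
  have hΘ : ∀ s, HasDerivAt Θ (θ s) s := fun s =>
    intervalIntegral.integral_hasDerivAt_right (hθ.intervalIntegrable _ _)
      (hθ.stronglyMeasurableAtFilter _ _) hθ.continuousAt
  have hG : ∀ s, HasDerivAt (fun s => f s * Real.exp (-Θ s)) 0 s := fun s => by
    refine ((hf s).mul (hΘ s).fun_neg.exp).congr_deriv ?_
    ring
  have hconst : f s * Real.exp (-Θ s) = f 0 * Real.exp (-Θ 0) :=
    is_const_of_deriv_eq_zero (fun s => (hG s).differentiableAt) (fun s => (hG s).deriv) s 0
  have : 0 < f s * Real.exp (-Θ s) := by rw [hconst]; positivity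
  exact pos_of_mul_pos_left this (Real.exp_pos _).le

/-- The data of a flow `W` of a vector field `K` that is a cut-off of
`(x, α y, β z)` near the cylinder, where `α` and `β` are perturbations of `-lam` and `-mu`. -/
structure SaddleFlow (lam mu : ℝ) (α β χ : ℝ × ℝ × ℝ → ℝ) (K : ℝ × ℝ × ℝ → ℝ × ℝ × ℝ)
    (W : ℝ × ℝ × ℝ → ℝ → ℝ × ℝ × ℝ) : Prop where
  isFlow : IsFlow K W
  lipschitz : ∃ C, LipschitzWith C K
  field_eq : ∀ p, K p = (χ p * p.1, χ p * α p * p.2.1, χ p * β p * p.2.2)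
  cutoff_mem : ∀ p, χ p ∈ Icc (0 : ℝ) 1
  cutoff_eq_one : ∀ p ∈ Bcyl, χ p = 1
  continuous_cutoff : Continuous χ
  continuous_alpha : Continuous fun p => χ p * α p
  continuous_beta : Continuous fun p => χ p * β p
  analyticAt : ∀ p ∈ Bcyl, AnalyticAt ℝ K p
  rate_bound : ∃ C, ∀ p ∈ Bcyl, |α p + lam| ≤ C * ‖p‖ ∧ |β p + mu| ≤ C * ‖p‖
  radial_bound : ∃ δ η : ℝ, 0 < δ ∧ 0 < η ∧ ∀ p ∈ Bcyl,
    α p * p.2.1 ^ 2 + β p * p.2.2 ^ 2 ≤ -δ * (1 - p.1 / η) * (p.2.1 ^ 2 + p.2.2 ^ 2)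
  radial_neg : ∀ p ∈ Bcyl, (p.2.1, p.2.2) ≠ ((0 : ℝ), (0 : ℝ)) →
    α p * p.2.1 ^ 2 + β p * p.2.2 ^ 2 < 0

namespace SaddleFlow

variable {lam mu : ℝ} {α β χ : ℝ × ℝ × ℝ → ℝ} {K : ℝ × ℝ × ℝ → ℝ × ℝ × ℝ}
  {W : ℝ × ℝ × ℝ → ℝ → ℝ × ℝ × ℝ} {p : ℝ × ℝ × ℝ}

section
variable (h : SaddleFlow lam mu α β χ K W)
include h

theorem hasDerivAt_x (p : ℝ × ℝ × ℝ) (s : ℝ) :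
    HasDerivAt (fun s => (W p s).1) (χ (W p s) * (W p s).1) s := by
  have := ((h.isFlow p).2 s).fst
  rwa [h.field_eq] at this

theorem hasDerivAt_y (p : ℝ × ℝ × ℝ) (s : ℝ) :
    HasDerivAt (fun s => (W p s).2.1) (χ (W p s) * α (W p s) * (W p s).2.1) s := by
  have := ((h.isFlow p).2 s).snd.fst
  rwa [h.field_eq] at this

theorem hasDerivAt_z (p : ℝ × ℝ × ℝ) (s : ℝ) :
    HasDerivAt (fun s => (W p s).2.2) (χ (W p s) * β (W p s) * (W p s).2.2) s := by
  have := ((h.isFlow p).2 s).snd.snd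
  rwa [h.field_eq] at this

theorem hasDerivAt_radius_sq (p : ℝ × ℝ × ℝ) (s : ℝ) :
    HasDerivAt (fun s => (W p s).2.1 ^ 2 + (W p s).2.2 ^ 2)
      (2 * χ (W p s) * (α (W p s) * (W p s).2.1 ^ 2 + β (W p s) * (W p s).2.2 ^ 2)) s := by
  refine (((h.hasDerivAt_y p s).fun_pow 2).fun_add ((h.hasDerivAt_z p s).fun_pow 2)).congr_deriv ?_
  push_cast
  ring

theorem x_pos (hx : 0 < p.1) (s : ℝ) : 0 < (W p s).1 :=
  pos_of_hasDerivAt_mul_self (h.continuous_cutoff.comp (h.isFlow.continuous p))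
    (h.hasDerivAt_x p) (by simpa [(h.isFlow p).1] using hx) s

theorem y_pos (hy : 0 < p.2.1) (s : ℝ) : 0 < (W p s).2.1 :=
  pos_of_hasDerivAt_mul_self (f := fun s => (W p s).2.1)
    (h.continuous_alpha.comp (h.isFlow.continuous p))
    (h.hasDerivAt_y p) (by simpa [(h.isFlow p).1] using hy) s

theorem z_pos (hz : 0 < p.2.2) (s : ℝ) : 0 < (W p s).2.2 :=
  pos_of_hasDerivAt_mul_self (f := fun s => (W p s).2.2)
    (h.continuous_beta.comp (h.isFlow.continuous p))
    (h.hasDerivAt_z p) (by simpa [(h.isFlow p).1] using hz) s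

theorem x_le (hx : 0 < p.1) {s : ℝ} (hs : 0 ≤ s) : (W p s).1 ≤ p.1 * Real.exp s := by
  have hd : ∀ s, HasDerivAt (fun s => (W p s).1 * Real.exp (-s))
      ((χ (W p s) - 1) * ((W p s).1 * Real.exp (-s))) s := fun s => by
    refine ((h.hasDerivAt_x p s).mul (hasDerivAt_neg s).exp).congr_deriv ?_
    ring
  have hanti : Antitone fun s => (W p s).1 * Real.exp (-s) :=
    antitone_of_deriv_nonpos (fun s => (hd s).differentiableAt) fun s => by
      rw [(hd s).deriv]
      exact mul_nonpos_of_nonpos_of_nonneg (by linarith [(h.cutoff_mem (W p s)).2])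
        (mul_pos (h.x_pos hx s) (Real.exp_pos _)).le
  have := hanti hs
  simp only [neg_zero, Real.exp_zero, mul_one, (h.isFlow p).1] at this
  calc (W p s).1 = (W p s).1 * Real.exp (-s) * Real.exp s := by
        rw [mul_assoc, ← Real.exp_add]; simp
    _ ≤ p.1 * Real.exp s := by gcongr

/-- Orbits starting in the cylinder with positive coordinates stay there until `x = 1`. -/
theorem mem_Bcyl (hp : p ∈ Bcyl) (hx : 0 < p.1) (hy : 0 < p.2.1) (hz : 0 < p.2.2) {s : ℝ}
    (hs : s ∈ Icc 0 (-Real.log p.1)) : W p s ∈ Bcyl := by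
  have hcl : IsClosed (W p ⁻¹' Bcyl ∩ Icc 0 (-Real.log p.1)) :=
    (isCompact_Bcyl.isClosed.preimage (h.isFlow.continuous p)).inter isClosed_Icc
  refine hcl.Icc_subset_of_forall_mem_nhdsWithin (by simpa [(h.isFlow p).1] using hp) ?_ hs
  rintro r ⟨hrB, hr0, hr1⟩
  have hx1 : (W p r).1 < 1 := by
    refine (h.x_le hx hr0).trans_lt ?_
    calc p.1 * Real.exp r < p.1 * Real.exp (-Real.log p.1) := by gcongr
      _ = 1 := by rw [Real.exp_neg, Real.exp_log hx, mul_inv_cancel₀ hx.ne']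
  have hxev : ∀ᶠ s in 𝓝[>] r, (W p s).1 < 1 :=
    ((h.hasDerivAt_x p r).continuousAt.eventually_lt continuousAt_const hx1).filter_mono
      nhdsWithin_le_nhds
  have hrev : ∀ᶠ s in 𝓝[>] r, (W p s).2.1 ^ 2 + (W p s).2.2 ^ 2 ≤ 1 := by
    have hneg := h.radial_neg _ hrB fun e =>
      (h.y_pos hy r).ne' (Prod.mk.inj e).1
    have hd := h.hasDerivAt_radius_sq p r
    rw [h.cutoff_eq_one _ hrB, mul_one] at hd
    have hsl := (hasDerivAt_iff_tendsto_slope.mp hd).eventually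
      (gt_mem_nhds (show 2 * (α (W p r) * (W p r).2.1 ^ 2 + β (W p r) * (W p r).2.2 ^ 2) < 0 by
        linarith))
    filter_upwards [hsl.filter_mono (nhdsWithin_mono r fun s (hs : r < s) => hs.ne'),
      self_mem_nhdsWithin] with s hs1 hs2
    rw [slope_def_field, div_neg_iff] at hs1
    have := hrB.2.2.2.2
    rcases hs1 with hs1 | hs1
    · have : r < s := hs2
      linarith
    · linarith
  filter_upwards [hxev, hrev] with s h1 h2
  exact ⟨(h.x_pos hx s).le, h1.le, (h.y_pos hy s).le, (h.z_pos hz s).le, h2⟩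

theorem x_eq (hp : p ∈ Bcyl) (hx : 0 < p.1) (hy : 0 < p.2.1) (hz : 0 < p.2.2) {s : ℝ}
    (hs : s ∈ Icc 0 (-Real.log p.1)) : (W p s).1 = p.1 * Real.exp s := by
  have hd : ∀ s, HasDerivAt (fun s => (W p s).1 * Real.exp (-s))
      ((χ (W p s) - 1) * ((W p s).1 * Real.exp (-s))) s := fun s => by
    refine ((h.hasDerivAt_x p s).mul (hasDerivAt_neg s).exp).congr_deriv ?_
    ring
  have := constant_of_has_deriv_right_zero
    (fun s _ => (hd s).continuousAt.continuousWithinAt) (fun s hs => by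
      have := (hd s).hasDerivWithinAt (s := Ici s)
      rwa [h.cutoff_eq_one _ (h.mem_Bcyl hp hx hy hz (Ico_subset_Icc_self hs)), sub_self,
        zero_mul] at this) s hs
  simp only [neg_zero, Real.exp_zero, mul_one, (h.isFlow p).1] at this
  rw [← this, mul_assoc, ← Real.exp_add]
  simp

theorem x_end (hp : p ∈ Bcyl) (hx : 0 < p.1) (hy : 0 < p.2.1) (hz : 0 < p.2.2) :
    (W p (-Real.log p.1)).1 = 1 := by
  have := Real.log_nonpos hx.le hp.2.1
  rw [h.x_eq hp hx hy hz ⟨by linarith, le_rfl⟩, Real.exp_neg, Real.exp_log hx,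
    mul_inv_cancel₀ hx.ne']

/-- A uniformly bounded function whose derivative along orbits dominates the norm. -/
theorem exists_potential : ∃ A B : ℝ, ∀ p ∈ Bcyl, 0 < p.1 → 0 < p.2.1 → 0 < p.2.2 →
    ∃ Q Q' : ℝ → ℝ, (∀ s, HasDerivAt Q (Q' s) s) ∧
      (∀ s ∈ Icc 0 (-Real.log p.1), ‖W p s‖ ≤ Q' s ∧ A ≤ Q s ∧ Q s ≤ B) := by
  obtain ⟨δ, η, hδ, hη, hrad⟩ := h.radial_bound
  refine ⟨-(2 / δ), 1 + 2 / η, fun p hp hx hy hz => ?_⟩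
  have hpos : ∀ s, 0 < (W p s).2.1 ^ 2 + (W p s).2.2 ^ 2 := fun s => by
    have := h.y_pos hy s; positivity
  refine ⟨fun s => (1 + 2 / η) * (W p s).1 - 2 / δ * √((W p s).2.1 ^ 2 + (W p s).2.2 ^ 2), _,
    fun s => ((h.hasDerivAt_x p s).const_mul _).sub
      (((h.hasDerivAt_radius_sq p s).sqrt (hpos s).ne').const_mul _), fun s hs => ?_⟩
  beta_reduce
  have hB := h.mem_Bcyl hp hx hy hz hs
  rw [h.cutoff_eq_one _ hB]
  have hr := hrad _ hB
  have hp2 := hpos s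
  have hx0 := (h.x_pos hx s).le
  have hy0 := h.y_pos hy s
  have hz0 := h.z_pos hz s
  obtain ⟨-, hx1, -, -, hB5⟩ := hB
  generalize hq : W p s = q at *
  obtain ⟨x, y, z⟩ := q
  simp only at *
  set r := √(y ^ 2 + z ^ 2) with hrdef
  have hr2 : r ^ 2 = y ^ 2 + z ^ 2 := Real.sq_sqrt hp2.le
  have hr0 : 0 < r := Real.sqrt_pos.mpr hp2
  have hr1 : r ≤ 1 := Real.sqrt_le_one.mpr hB5
  have hyr : y ≤ r := Real.le_sqrt_of_sq_le (by nlinarith)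
  have hzr : z ≤ r := Real.le_sqrt_of_sq_le (by nlinarith)
  refine ⟨?_, ?_, ?_⟩
  · have hn : ‖(x, y, z)‖ ≤ x + 2 * r := by
      rw [Prod.norm_mk, Prod.norm_mk, Real.norm_of_nonneg hx0, Real.norm_of_nonneg hy0.le,
        Real.norm_of_nonneg hz0.le]
      refine max_le (by linarith) (max_le (by linarith) (by linarith))
    refine hn.trans ?_
    rw [← hr2] at hr
    have hdiv : 2 * 1 * (α (x, y, z) * y ^ 2 + β (x, y, z) * z ^ 2) / (2 * r)
        ≤ -δ * (1 - x / η) * r := by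
      rw [div_le_iff₀ (by positivity)]
      nlinarith
    have h3 : 2 / δ * (2 * 1 * (α (x, y, z) * y ^ 2 + β (x, y, z) * z ^ 2) / (2 * r))
        ≤ 2 / δ * (-δ * (1 - x / η) * r) := by gcongr
    have h4 : 2 / δ * (-δ * (1 - x / η) * r) = -2 * r + 2 * (x / η) * r := by
      field_simp; ring
    have h5 : 2 * (x / η) * r ≤ 2 * (x / η) := by
      have : 0 ≤ 2 * (x / η) := by positivity
      nlinarith
    have h6 : (1 + 2 / η) * (1 * x) = x + 2 * (x / η) := by ring
    linarith
  · have : 2 / δ * r ≤ 2 / δ := by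
      have : 0 < 2 / δ := by positivity
      nlinarith
    have : 0 ≤ (1 + 2 / η) * x := by positivity
    linarith
  · have : 0 ≤ 2 / δ * r := by positivity
    have : (1 + 2 / η) * x ≤ 1 + 2 / η := by
      have : 0 < 1 + 2 / η := by positivity
      nlinarith
    linarith

/-- Uniform logarithmic asymptotics of the transition map. -/
theorem exists_log_bound : ∃ M : ℝ, ∀ p ∈ Bcyl, 0 < p.1 → 0 < p.2.1 → 0 < p.2.2 →
    |Real.log (W p (-Real.log p.1)).2.1 - (Real.log p.2.1 + lam * Real.log p.1)| ≤ M ∧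
    |Real.log (W p (-Real.log p.1)).2.2 - (Real.log p.2.2 + mu * Real.log p.1)| ≤ M := by
  obtain ⟨C, hC⟩ := h.rate_bound
  obtain ⟨A, B, hAB⟩ := h.exists_potential
  refine ⟨|C| * (B - A), fun p hp hx hy hz => ?_⟩
  obtain ⟨Q, Q', hQ, hQb⟩ := hAB p hp hx hy hz
  set L := -Real.log p.1 with hL
  have hL0 : 0 ≤ L := by linarith [Real.log_nonpos hx.le hp.2.1]
  have key : ∀ (f θ : ℝ → ℝ) (m : ℝ), (∀ s, HasDerivAt f (θ s * f s) s) → (∀ s, 0 < f s) →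
      (∀ s ∈ Icc 0 L, |θ s + m| ≤ C * ‖W p s‖) →
      |Real.log (f L) - (Real.log (f 0) + m * -L)| ≤ |C| * (B - A) := by
    intro f θ m hf hpos hb
    have hd : ∀ s, HasDerivAt (fun s => Real.log (f s) - Real.log (f 0) + m * s) (θ s + m) s :=
      fun s => by
        refine ((((hf s).log (hpos s).ne').sub_const (Real.log (f 0))).fun_add
          ((hasDerivAt_id s).const_mul m)).congr_deriv ?_
        rw [mul_div_cancel_right₀ _ (hpos s).ne', mul_one]
    have := image_norm_le_of_norm_deriv_right_le_deriv_boundary (a := 0) (b := L)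
      (f := fun s => Real.log (f s) - Real.log (f 0) + m * s) (f' := fun s => θ s + m)
      (B := fun s => |C| * (Q s - Q 0)) (B' := fun s => |C| * Q' s)
      (fun s _ => (hd s).continuousAt.continuousWithinAt) (fun s _ => (hd s).hasDerivWithinAt)
      (by simp) (fun s => ((hQ s).sub_const _).const_mul _) (fun s hs => by
        have h1 := hb s (Ico_subset_Icc_self hs)
        have h2 := (hQb s (Ico_subset_Icc_self hs)).1
        calc ‖θ s + m‖ ≤ C * ‖W p s‖ := h1
          _ ≤ |C| * ‖W p s‖ := by gcongr; exact le_abs_self C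
          _ ≤ |C| * Q' s := by gcongr) (x := L) ⟨hL0, le_rfl⟩
    simp only [Real.norm_eq_abs] at this
    have h3 := (hQb L ⟨hL0, le_rfl⟩).2.2
    have h4 := (hQb 0 ⟨le_rfl, hL0⟩).2.1
    have h5 : |C| * (Q L - Q 0) ≤ |C| * (B - A) := by gcongr
    calc _ = |Real.log (f L) - Real.log (f 0) + m * L| := by congr 1; ring
      _ ≤ _ := this.trans h5
  have hlog : Real.log p.1 = -L := by rw [hL, neg_neg]
  rw [hlog]
  have hBs : ∀ s ∈ Icc 0 L, W p s ∈ Bcyl := fun s hs => h.mem_Bcyl hp hx hy hz hs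
  constructor
  · have := key (fun s => (W p s).2.1) _ lam (h.hasDerivAt_y p) (h.y_pos hy) (fun s hs => by
      simpa [h.cutoff_eq_one _ (hBs s hs)] using (hC _ (hBs s hs)).1)
    simpa only [(h.isFlow p).1] using this
  · have := key (fun s => (W p s).2.2) _ mu (h.hasDerivAt_z p) (h.z_pos hz) (fun s hs => by
      simpa [h.cutoff_eq_one _ (hBs s hs)] using (hC _ (hBs s hs)).2)
    simpa only [(h.isFlow p).1] using this

end
end SaddleFlow
end Saddle

section Construction

open Topology

theorem contDiff_mul_of_eq_zero {E : Type*} [NormedAddCommGroup E] [NormedSpace ℝ E]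
    {χ f : E → ℝ} {t : Set E} (hχ : ContDiff ℝ 1 χ) (ht : IsClosed t)
    (h0 : ∀ x ∉ t, χ x = 0) (hf : ∀ x ∈ t, AnalyticAt ℝ f x) :
    ContDiff ℝ 1 fun x => χ x * f x := by
  refine contDiff_iff_contDiffAt.mpr fun x => ?_
  by_cases hx : x ∈ t
  · exact hχ.contDiffAt.mul (hf x hx).contDiffAt
  · refine (contDiffAt_const (c := (0 : ℝ))).congr_of_eventuallyEq ?_
    filter_upwards [ht.isOpen_compl.mem_nhds hx] with y hy
    rw [h0 y hy, zero_mul]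

theorem exists_cutoff {E : Type*} [NormedAddCommGroup E] [NormedSpace ℝ E]
    [FiniteDimensional ℝ E] {B V : Set E} (hB : IsCompact B) (hV : IsOpen V) (hBV : B ⊆ V) :
    ∃ (χ : E → ℝ) (t : Set E), IsCompact t ∧ t ⊆ V ∧ ContDiff ℝ 1 χ ∧
      (∀ x ∈ B, χ =ᶠ[𝓝 x] 1) ∧ (∀ x, χ x ∈ Icc (0 : ℝ) 1) ∧ ∀ x ∉ t, χ x = 0 := by
  obtain ⟨t, ht, hBt, htV⟩ := exists_compact_between hB hV hBV
  obtain ⟨χ, h1, h0, h01⟩ := exists_contMDiffMap_one_nhds_of_subset_interior (n := 1)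
    (modelWithCornersSelf ℝ E) hB.isClosed hBt
  exact ⟨χ, t, ht, htV, χ.contMDiff.contDiff, fun x hx => eventually_nhdsSet_iff_forall.mp h1 x hx,
    h01, h0⟩

theorem exists_radial_bound {lam mu : ℝ} {α β : ℝ × ℝ × ℝ → ℝ} (hlam : 0 < lam) (hmu : 0 < mu)
    (hα : ContinuousOn α Bcyl) (hβ : ContinuousOn β Bcyl)
    (hα' : ContinuousAt α 0) (hβ' : ContinuousAt β 0) (hα0 : α 0 = -lam) (hβ0 : β 0 = -mu)
    (hneg : ∀ p ∈ Bcyl, (p.2.1, p.2.2) ≠ ((0 : ℝ), (0 : ℝ)) →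
      α p * p.2.1 ^ 2 + β p * p.2.2 ^ 2 < 0) :
    ∃ δ η : ℝ, 0 < δ ∧ 0 < η ∧ ∀ p ∈ Bcyl,
      α p * p.2.1 ^ 2 + β p * p.2.2 ^ 2 ≤ -δ * (1 - p.1 / η) * (p.2.1 ^ 2 + p.2.2 ^ 2) := by
  have hev : ∀ᶠ p in 𝓝 (0 : ℝ × ℝ × ℝ), α p < -lam / 2 ∧ β p < -mu / 2 :=
    (hα'.eventually (gt_mem_nhds (by linarith))).and (hβ'.eventually (gt_mem_nhds (by linarith)))
  obtain ⟨η, hη, hball⟩ := Metric.eventually_nhds_iff.mp hev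
  let S : Set (ℝ × ℝ × ℝ) := Bcyl ∩ ({p | η ≤ p.2.1} ∪ {p | η ≤ p.2.2})
  have hS : IsCompact S := isCompact_Bcyl.inter_right
    ((isClosed_le continuous_const (continuous_fst.comp continuous_snd)).union
      (isClosed_le continuous_const (continuous_snd.comp continuous_snd)))
  have hF : ContinuousOn (fun p : ℝ × ℝ × ℝ => α p * p.2.1 ^ 2 + β p * p.2.2 ^ 2) S := by
    have := hα.mono (inter_subset_left : S ⊆ Bcyl)
    have := hβ.mono (inter_subset_left : S ⊆ Bcyl)
    fun_prop
  have hS0 : ∀ p ∈ S, α p * p.2.1 ^ 2 + β p * p.2.2 ^ 2 < 0 := by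
    rintro p ⟨hp, hp'⟩
    refine hneg p hp fun e => ?_
    obtain ⟨e1, e2⟩ := Prod.mk.inj e
    rcases hp' with h | h
    · exact absurd (e1 ▸ h : η ≤ 0) (by linarith)
    · exact absurd (e2 ▸ h : η ≤ 0) (by linarith)
  obtain ⟨δ', hδ', hSδ⟩ : ∃ δ' > 0, ∀ p ∈ S, α p * p.2.1 ^ 2 + β p * p.2.2 ^ 2 ≤ -δ' := by
    rcases S.eq_empty_or_nonempty with he | hne
    · exact ⟨1, one_pos, by simp [he]⟩
    · obtain ⟨q, hq, hmax⟩ := hS.exists_isMaxOn hne hF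
      exact ⟨_, neg_pos.mpr (hS0 q hq), fun p hp => by simpa using hmax hp⟩
  refine ⟨min (min (lam / 2) (mu / 2)) δ', η, by positivity, hη, ?_⟩
  intro p hp
  set δ := min (min (lam / 2) (mu / 2)) δ' with hδ
  have hδ0 : 0 < δ := by positivity
  have hδ1 : δ ≤ lam / 2 := (min_le_left _ _).trans (min_le_left _ _)
  have hδ2 : δ ≤ mu / 2 := (min_le_left _ _).trans (min_le_right _ _)
  have hδ3 : δ ≤ δ' := min_le_right _ _
  obtain ⟨hx0, hx1, hy0, hz0, hr⟩ := id hp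
  have hr0 : 0 ≤ p.2.1 ^ 2 + p.2.2 ^ 2 := by positivity
  rcases le_or_gt η p.1 with hx | hx
  · have h1 : 1 ≤ p.1 / η := by rwa [one_le_div hη]
    have h2 : α p * p.2.1 ^ 2 + β p * p.2.2 ^ 2 ≤ 0 := by
      by_cases e : (p.2.1, p.2.2) = ((0 : ℝ), (0 : ℝ))
      · obtain ⟨e1, e2⟩ := Prod.mk.inj e
        simp [e1, e2]
      · exact (hneg p hp e).le
    refine h2.trans ?_
    have : 0 ≤ -δ * (1 - p.1 / η) := by nlinarith
    positivity
  · have h1 : 0 ≤ p.1 / η := by positivity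
    have h3 : -δ * (p.2.1 ^ 2 + p.2.2 ^ 2)
        ≤ -δ * (1 - p.1 / η) * (p.2.1 ^ 2 + p.2.2 ^ 2) := by
      gcongr
      nlinarith
    refine le_trans ?_ h3
    by_cases hpS : p ∈ S
    · have := hSδ p hpS
      nlinarith
    · have hy : p.2.1 < η := not_le.mp fun h => hpS ⟨hp, Or.inl h⟩
      have hz : p.2.2 < η := not_le.mp fun h => hpS ⟨hp, Or.inr h⟩
      have hd : dist p 0 < η := by
        rw [dist_zero_right, Prod.norm_def, Prod.norm_def, Real.norm_of_nonneg hx0,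
          Real.norm_of_nonneg hy0, Real.norm_of_nonneg hz0]
        exact max_lt hx (max_lt hy hz)
      obtain ⟨ha, hb⟩ := hball hd
      have := mul_le_mul_of_nonneg_right (show α p ≤ -δ by linarith) (sq_nonneg p.2.1)
      have := mul_le_mul_of_nonneg_right (show β p ≤ -δ by linarith) (sq_nonneg p.2.2)
      linarith

/-- After division by the speed of the first coordinate and a cut-off, the saddle is globally
integrable. -/
theorem exists_saddleFlow {lam mu : ℝ} (hlam : 0 < lam) (hmu : 0 < mu)
    {V : Set (ℝ × ℝ × ℝ)} (hVopen : IsOpen V) (hBV : Bcyl ⊆ V) {a b c : ℝ × ℝ × ℝ → ℝ}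
    (ha : AnalyticOnNhd ℝ a V) (hb : AnalyticOnNhd ℝ b V) (hc : AnalyticOnNhd ℝ c V)
    (ha0 : a 0 = 0) (hb0 : b 0 = 0) (hc0 : c 0 = 0)
    (htrans1 : ∀ p ∈ Bcyl, 0 < 1 + a p)
    (htrans2 : ∀ p ∈ Bcyl, (p.2.1, p.2.2) ≠ ((0 : ℝ), (0 : ℝ)) →
      (-lam + b p) * p.2.1 ^ 2 + (-mu + c p) * p.2.2 ^ 2 < 0) :
    ∃ (α β χ : ℝ × ℝ × ℝ → ℝ) (K : ℝ × ℝ × ℝ → ℝ × ℝ × ℝ) (W : ℝ × ℝ × ℝ → ℝ → ℝ × ℝ × ℝ),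
      SaddleFlow lam mu α β χ K W ∧
      ∀ p ∈ Bcyl, ((1 + a p) * p.1, (-lam + b p) * p.2.1, (-mu + c p) * p.2.2)
        = (1 + a p) • K p := by
  let U := V ∩ a ⁻¹' Ioi (-1)
  have hU : IsOpen U := ha.continuousOn.isOpen_inter_preimage hVopen isOpen_Ioi
  have hBU : Bcyl ⊆ U := fun p hp => ⟨hBV hp, by
    have := htrans1 p hp
    change -1 < a p
    linarith⟩
  have hU1 : ∀ p ∈ U, 0 < 1 + a p := fun p hp => by
    have : -1 < a p := hp.2
    linarith
  let α : ℝ × ℝ × ℝ → ℝ := fun p => (-lam + b p) / (1 + a p)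
  let β : ℝ × ℝ × ℝ → ℝ := fun p => (-mu + c p) / (1 + a p)
  have hα : ∀ p ∈ U, AnalyticAt ℝ α p := fun p hp =>
    (analyticAt_const.fun_add (hb p hp.1)).fun_div (analyticAt_const.fun_add (ha p hp.1))
      (hU1 p hp).ne'
  have hβ : ∀ p ∈ U, AnalyticAt ℝ β p := fun p hp =>
    (analyticAt_const.fun_add (hc p hp.1)).fun_div (analyticAt_const.fun_add (ha p hp.1))
      (hU1 p hp).ne'
  have hα0 : α 0 = -lam := by simp [α, ha0, hb0]
  have hβ0 : β 0 = -mu := by simp [β, ha0, hc0]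
  have h0B : (0 : ℝ × ℝ × ℝ) ∈ Bcyl := by simp [Bcyl]
  have hneg : ∀ p ∈ Bcyl, (p.2.1, p.2.2) ≠ ((0 : ℝ), (0 : ℝ)) →
      α p * p.2.1 ^ 2 + β p * p.2.2 ^ 2 < 0 := fun p hp hne => by
    have : α p * p.2.1 ^ 2 + β p * p.2.2 ^ 2
        = ((-lam + b p) * p.2.1 ^ 2 + (-mu + c p) * p.2.2 ^ 2) / (1 + a p) := by
      simp only [α, β]; ring
    rw [this]
    exact div_neg_of_neg_of_pos (htrans2 p hp hne) (htrans1 p hp)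
  obtain ⟨χ, t, ht, htU, hχ, hχ1, hχ01, hχ0⟩ := exists_cutoff isCompact_Bcyl hU hBU
  have hχB : ∀ p ∈ Bcyl, χ p = 1 := fun p hp => (hχ1 p hp).eq_of_nhds
  have hcd : ∀ f : ℝ × ℝ × ℝ → ℝ, (∀ p ∈ U, AnalyticAt ℝ f p) →
      ContDiff ℝ 1 fun p => χ p * f p := fun f hf =>
    contDiff_mul_of_eq_zero hχ ht.isClosed hχ0 fun p hp => hf p (htU hp)
  have hrate : ∀ (f : ℝ × ℝ × ℝ → ℝ) (m : ℝ), (∀ p ∈ U, AnalyticAt ℝ f p) → f 0 = -m →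
      ∃ C, ∀ p ∈ Bcyl, |f p + m| ≤ C * ‖p‖ := fun f m hf hf0 => by
    obtain ⟨C, hC⟩ := (hcd (fun p => f p + m) fun p hp =>
      (hf p hp).fun_add analyticAt_const).lipschitzWith_of_hasCompactSupport
      (HasCompactSupport.intro ht fun p hp => by simp [hχ0 p hp]) one_ne_zero
    refine ⟨C, fun p hp => ?_⟩
    have := hC.dist_le_mul p 0
    simpa [hχB p hp, hf0, Real.dist_eq] using this
  let K : ℝ × ℝ × ℝ → ℝ × ℝ × ℝ := fun p => (χ p * p.1, χ p * α p * p.2.1, χ p * β p * p.2.2)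
  have hK : ContDiff ℝ 1 K := by
    have := hcd α hα
    have := hcd β hβ
    fun_prop
  have hKs : HasCompactSupport K := HasCompactSupport.intro ht fun p hp => by simp [K, hχ0 p hp]
  obtain ⟨C, hC⟩ := hK.lipschitzWith_of_hasCompactSupport hKs one_ne_zero
  obtain ⟨M, hM⟩ := hKs.exists_bound_of_continuous hK.continuous
  obtain ⟨W, hW⟩ := exists_isFlow hC hM
  obtain ⟨C₁, hC₁⟩ := hrate α lam hα hα0
  obtain ⟨C₂, hC₂⟩ := hrate β mu hβ hβ0
  refine ⟨α, β, χ, K, W, ⟨hW, ⟨C, hC⟩, fun p => rfl, hχ01, hχB, hχ.continuous,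
    (hcd α hα).continuous, (hcd β hβ).continuous, fun p hp => ?_, ⟨max C₁ C₂, fun p hp =>
      ⟨(hC₁ p hp).trans (by gcongr; exact le_max_left _ _),
        (hC₂ p hp).trans (by gcongr; exact le_max_right _ _)⟩⟩,
    exists_radial_bound hlam hmu (fun p hp => (hα p (hBU hp)).continuousAt.continuousWithinAt)
      (fun p hp => (hβ p (hBU hp)).continuousAt.continuousWithinAt)
      (hα 0 (hBU h0B)).continuousAt (hβ 0 (hBU h0B)).continuousAt hα0 hβ0 hneg,
    hneg⟩, fun p hp => ?_⟩
  · have h1 := hα p (hBU hp)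
    have h2 := hβ p (hBU hp)
    have : AnalyticAt ℝ (fun p : ℝ × ℝ × ℝ => (p.1, α p * p.2.1, β p * p.2.2)) p :=
      AnalyticAt.prod analyticAt_fst ((h1.fun_mul (analyticAt_fst.fun_comp analyticAt_snd)).prod
        (h2.fun_mul (analyticAt_snd.fun_comp analyticAt_snd)))
    refine this.congr ?_
    filter_upwards [hχ1 p hp] with q hq
    simp [K, hq]
  · have := (htrans1 p hp).ne'
    simp only [K, hχB p hp, α, β, Prod.smul_mk, smul_eq_mul]
    refine Prod.ext (by ring) (Prod.ext ?_ ?_) <;> simp only <;> field_simp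

end Construction

section Transition

open Topology

theorem fencePhi_pos {q : ℝ × ℝ} (hq : q ∈ Ioo (0 : ℝ) 1 ×ˢ Ioo (0 : ℝ) 1) :
    0 < (fencePhi q).1 ∧ 0 < (fencePhi q).2.1 ∧ 0 < (fencePhi q).2.2 := by
  obtain ⟨⟨h1, h2⟩, h3, h4⟩ := hq
  have hpi := Real.pi_pos
  exact ⟨h3, Real.cos_pos_of_mem_Ioo ⟨by nlinarith, by nlinarith⟩,
    Real.sin_pos_of_pos_of_lt_pi (by positivity) (by nlinarith)⟩

theorem fencePhi_mem_Bcyl {q : ℝ × ℝ} (hq : q ∈ Ioo (0 : ℝ) 1 ×ˢ Ioo (0 : ℝ) 1) :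
    fencePhi q ∈ Bcyl := by
  obtain ⟨h1, h2, h3⟩ := fencePhi_pos hq
  exact ⟨h1.le, hq.2.2.le, h2.le, h3.le, (Real.cos_sq_add_sin_sq _).le⟩

theorem analyticAt_fencePhi (q : ℝ × ℝ) : AnalyticAt ℝ fencePhi q := by
  have h : AnalyticAt ℝ (fun q : ℝ × ℝ => Real.pi * q.1 / 2) q := by
    simp only [mul_div_right_comm]
    exact analyticAt_const.fun_mul analyticAt_fst
  exact AnalyticAt.prod analyticAt_snd
    ((Real.analyticAt_cos.comp h).prod (Real.analyticAt_sin.comp h))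

/-- The map sending the fence parameters to the exit point in the plane `x = 1`. -/
noncomputable def transition (W : ℝ × ℝ × ℝ → ℝ → ℝ × ℝ × ℝ) (q : ℝ × ℝ) : ℝ × ℝ :=
  (W (fencePhi q) (-Real.log q.2)).2

namespace SaddleFlow

variable {lam mu : ℝ} {α β χ : ℝ × ℝ × ℝ → ℝ} {K : ℝ × ℝ × ℝ → ℝ × ℝ × ℝ}
  {W : ℝ × ℝ × ℝ → ℝ → ℝ × ℝ × ℝ} {q : ℝ × ℝ}

section
variable (h : SaddleFlow lam mu α β χ K W)
include h

theorem mem_Bcyl_of_fencePhi (hq : q ∈ Ioo (0 : ℝ) 1 ×ˢ Ioo (0 : ℝ) 1) {s : ℝ}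
    (hs : s ∈ Icc 0 (-Real.log q.2)) : W (fencePhi q) s ∈ Bcyl :=
  have ⟨h1, h2, h3⟩ := fencePhi_pos hq
  h.mem_Bcyl (fencePhi_mem_Bcyl hq) h1 h2 h3 hs

theorem phiX_transition (hq : q ∈ Ioo (0 : ℝ) 1 ×ˢ Ioo (0 : ℝ) 1) :
    phiX (transition W q) = W (fencePhi q) (-Real.log q.2) :=
  have ⟨h1, h2, h3⟩ := fencePhi_pos hq
  Prod.ext (h.x_end (fencePhi_mem_Bcyl hq) h1 h2 h3).symm rfl

theorem transition_pos (hq : q ∈ Ioo (0 : ℝ) 1 ×ˢ Ioo (0 : ℝ) 1) :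
    0 < (transition W q).1 ∧ 0 < (transition W q).2 :=
  have ⟨_, h2, h3⟩ := fencePhi_pos hq
  ⟨h.y_pos h2 _, h.z_pos h3 _⟩

theorem analyticAt_transition (hq : q ∈ Ioo (0 : ℝ) 1 ×ˢ Ioo (0 : ℝ) 1) :
    AnalyticAt ℝ (transition W) q := by
  obtain ⟨C, hC⟩ := h.lipschitz
  have hL : 0 ≤ -Real.log q.2 := by linarith [Real.log_nonpos hq.2.1.le hq.2.2.le]
  have h1 := h.isFlow.analyticAt hC (p := fencePhi q) isPreconnected_Icc
    (show (0 : ℝ) ∈ Icc 0 (-Real.log q.2) from ⟨le_rfl, hL⟩)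
    (fun s hs => h.analyticAt _ (h.mem_Bcyl_of_fencePhi hq hs)) ⟨hL, le_rfl⟩
  have h2 : AnalyticAt ℝ (fun q : ℝ × ℝ => (fencePhi q, -Real.log q.2)) q :=
    (analyticAt_fencePhi q).prod (((analyticAt_log hq.2.1).comp analyticAt_snd).neg)
  exact AnalyticAt.comp (g := Prod.snd) analyticAt_snd
    (h1.comp_of_eq h2 rfl)

theorem deriv_transition_ne_zero {c : ℝ → ℝ × ℝ} {t : ℝ}
    (hc : ∀ᶠ s in 𝓝 t, c s ∈ Ioo (0 : ℝ) 1 ×ˢ Ioo (0 : ℝ) 1) (hcd : DifferentiableAt ℝ c t)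
    (hne : deriv c t ≠ 0) : deriv (fun s => transition W (c s)) t ≠ 0 := by
  intro h0
  obtain ⟨C, hC⟩ := h.lipschitz
  have hq := hc.self_of_nhds
  set q := c t with hqdef
  set L := -Real.log q.2 with hLdef
  have hL : 0 ≤ L := by linarith [Real.log_nonpos hq.2.1.le hq.2.2.le]
  have hback : ∀ {q : ℝ × ℝ}, q ∈ Ioo (0 : ℝ) 1 ×ˢ Ioo (0 : ℝ) 1 → ∀ s,
      W (phiX (transition W q)) s = W (fencePhi q) (-Real.log q.2 + s) := fun hq s => by
    rw [h.phiX_transition hq, h.isFlow.add hC]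
  have hF := (h.isFlow.analyticAt hC (p := phiX (transition W q)) isPreconnected_Icc
    (show (0 : ℝ) ∈ Icc (-L) 0 from ⟨by linarith, le_rfl⟩)
    (fun s hs => h.analyticAt _ (by
      rw [hback hq]
      exact h.mem_Bcyl_of_fencePhi hq ⟨by linarith [hs.1], by linarith [hs.2]⟩))
    (show -L ∈ Icc (-L) 0 from ⟨le_rfl, by linarith⟩)).differentiableAt.hasFDerivAt
  set F' := fderiv ℝ (fun x : (ℝ × ℝ × ℝ) × ℝ => W x.1 x.2) (phiX (transition W q), -L)
  have hend : W (phiX (transition W q)) (-L) = fencePhi q := by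
    rw [hback hq, ← hLdef, add_neg_cancel, (h.isFlow _).1]
  have hF1 : F' (0, 1) = K (fencePhi q) := by
    have h1 := hF.comp_hasDerivAt (-L)
      ((hasDerivAt_const (-L) (phiX (transition W q))).prodMk (hasDerivAt_id (-L)))
    have h2 := (h.isFlow (phiX (transition W q))).2 (-L)
    rw [hend] at h2
    exact h1.unique h2
  have hd : HasDerivAt (fun s => transition W (c s)) 0 t := by
    rw [← h0]
    exact ((h.analyticAt_transition hq).differentiableAt.comp t hcd).hasDerivAt
  have hc' := hcd.hasDerivAt
  have h1 : HasDerivAt (fun s => (c s).1) (deriv c t).1 t := hc'.fst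
  have h2 : HasDerivAt (fun s => (c s).2) (deriv c t).2 t := hc'.snd
  have hneg : -L = Real.log q.2 := neg_neg _
  have hfence : HasDerivAt (fun s => fencePhi (c s))
      (((deriv c t).2 / q.2) • K (fencePhi q)) t := by
    rw [hneg] at hF
    have h3 := hF.comp_hasDerivAt_of_eq t
      (((hasDerivAt_const t (1 : ℝ)).prodMk hd).prodMk (h2.log hq.2.1.ne')) rfl
    rw [← hF1, ← map_smul, Prod.smul_mk, smul_zero, smul_eq_mul, mul_one]
    refine h3.congr_of_eventuallyEq ?_
    filter_upwards [hc] with s hs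
    have := hback hs (Real.log (c s).2)
    rw [neg_add_cancel, (h.isFlow _).1] at this
    exact this.symm
  have hB := fencePhi_mem_Bcyl hq
  obtain ⟨-, hy, hz⟩ := fencePhi_pos hq
  have hv : (deriv c t).2 = 0 := by
    have h3 : HasDerivAt (fun s => (fencePhi (c s)).2.1)
      (((deriv c t).2 / q.2) • K (fencePhi q)).2.1 t := hfence.snd.fst
    have h4 : HasDerivAt (fun s => (fencePhi (c s)).2.2)
      (((deriv c t).2 / q.2) • K (fencePhi q)).2.2 t := hfence.snd.snd
    have h5 := (h3.fun_pow 2).fun_add (h4.fun_pow 2)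
    have h6 : HasDerivAt (fun s => (fencePhi (c s)).2.1 ^ 2 + (fencePhi (c s)).2.2 ^ 2) 0 t := by
      simp only [fencePhi, Real.cos_sq_add_sin_sq]
      exact hasDerivAt_const t 1
    have h7 := h5.unique h6
    rw [h.field_eq, h.cutoff_eq_one _ hB] at h7
    have h8 := h.radial_neg _ hB fun e => hy.ne' (Prod.mk.inj e).1
    simp only [Prod.smul_mk, smul_eq_mul, ← hqdef] at h7
    have h9 : (deriv c t).2 / q.2 * (α (fencePhi q) * (fencePhi q).2.1 ^ 2
        + β (fencePhi q) * (fencePhi q).2.2 ^ 2) = 0 := by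
      push_cast at h7
      linear_combination h7 / 2
    have := (mul_eq_zero.mp h9).resolve_right h8.ne
    exact (div_eq_zero_iff.mp this).resolve_right hq.2.1.ne'
  have hu : (deriv c t).1 = 0 := by
    rw [hv, zero_div, zero_smul] at hfence
    have h3 : HasDerivAt (fun s => Real.sin (Real.pi * (c s).1 / 2)) 0 t := hfence.snd.snd
    have h4 := h3.unique ((h1.const_mul Real.pi).div_const 2).sin
    have h5 := (mul_eq_zero.mp h4.symm).resolve_left hy.ne'
    have := Real.pi_pos.ne'
    simpa [this] using h5
  exact hne (Prod.ext hu hv)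

end
end SaddleFlow
end Transition

section Asymptotics

open Topology

theorem mul_rpow_lt_of_abs_log_sub_lt {u v σ R : ℝ} (hu : 0 < u) (hv : 0 < v)
    (hR : |Real.log v - σ * Real.log u| < R) :
    Real.exp (-R) * u ^ σ < v ∧ v < Real.exp R * u ^ σ := by
  obtain ⟨h1, h2⟩ := abs_lt.mp hR
  rw [Real.rpow_def_of_pos hu, ← Real.exp_add, ← Real.exp_add, ← Real.lt_log_iff_exp_lt hv,
    ← Real.log_lt_iff_lt_exp hv]
  constructor <;> linarith

theorem CurveHasWeight.exists_abs_log_sub_le {c : ℝ → ℝ × ℝ} {ρ : ℝ} (hw : CurveHasWeight c ρ)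
    (hpos : ∀ᶠ t in atTop, 0 < (c t).1 ∧ 0 < (c t).2) :
    ∃ N, ∀ᶠ t in atTop, |Real.log (c t).2 - ρ * Real.log (c t).1| ≤ N := by
  obtain ⟨k₁, k₂, t₀, hk₁, hk₂, -, hw⟩ := hw
  refine ⟨max |Real.log k₁| |Real.log k₂|, ?_⟩
  filter_upwards [hpos, eventually_gt_atTop t₀] with t ⟨hu, hv⟩ ht
  obtain ⟨h1, h2⟩ := hw t ht
  have hr := Real.rpow_pos_of_pos hu ρ
  have h3 := Real.log_lt_log (by positivity) h1
  have h4 := Real.log_lt_log hv h2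
  rw [Real.log_mul hk₁.ne' hr.ne', Real.log_rpow hu] at h3
  rw [Real.log_mul (hk₁.trans hk₂).ne' hr.ne', Real.log_rpow hu] at h4
  have h5 := neg_abs_le (Real.log k₁)
  have h6 := le_abs_self (Real.log k₂)
  have h7 := le_max_left |Real.log k₁| |Real.log k₂|
  have h8 := le_max_right |Real.log k₁| |Real.log k₂|
  exact abs_le.mpr ⟨by linarith, by linarith⟩

theorem curveHasWeight_of_eventually {c : ℝ → ℝ × ℝ} {σ R : ℝ}
    (hR : ∀ᶠ t in atTop, 0 < (c t).1 ∧ 0 < (c t).2 ∧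
      |Real.log (c t).2 - σ * Real.log (c t).1| ≤ R) : CurveHasWeight c σ := by
  obtain ⟨t₀, ht₀⟩ := eventually_atTop.mp hR
  have hR0 : 0 ≤ R := (abs_nonneg _).trans (ht₀ t₀ le_rfl).2.2
  refine ⟨Real.exp (-(R + 1)), Real.exp (R + 1), max t₀ 2, Real.exp_pos _,
    Real.exp_lt_exp.mpr (by linarith), by norm_num, fun t ht => ?_⟩
  obtain ⟨hu, hv, hb⟩ := ht₀ t ((le_max_left _ _).trans ht.le)
  exact mul_rpow_lt_of_abs_log_sub_lt hu hv (by linarith)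

theorem abs_log_fencePhi_sub_le {q : ℝ × ℝ} (hq : q ∈ Ioo (0 : ℝ) 1 ×ˢ Ioo (0 : ℝ) 1) :
    |Real.log (fencePhi q).2.2 - Real.log q.1| ≤ 1 := by
  obtain ⟨⟨h1, h2⟩, -⟩ := hq
  have hpi := Real.pi_pos
  have h3 : q.1 ≤ Real.sin (Real.pi * q.1 / 2) := by
    have := Real.mul_le_sin (x := Real.pi * q.1 / 2) (by positivity) (by nlinarith)
    calc q.1 = 2 / Real.pi * (Real.pi * q.1 / 2) := by field_simp
      _ ≤ _ := this
  have h4 : Real.sin (Real.pi * q.1 / 2) ≤ 2 * q.1 :=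
    (Real.sin_le (by positivity)).trans (by nlinarith [Real.pi_le_four])
  have h5 := Real.log_le_log h1 h3
  have h6 := Real.log_le_log (h1.trans_le h3) h4
  rw [Real.log_mul two_ne_zero h1.ne'] at h6
  have h7 := Real.log_two_lt_d9
  rw [show (fencePhi q).2.2 = Real.sin (Real.pi * q.1 / 2) from rfl]
  exact abs_le.mpr ⟨by linarith, by linarith⟩

theorem tendsto_zero_of_log {ι : Type*} {l : Filter ι} {f : ι → ℝ} (hf : ∀ᶠ t in l, 0 < f t)
    (h : Tendsto (fun t => Real.log (f t)) l atBot) : Tendsto f l (𝓝 0) :=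
  (Real.tendsto_exp_atBot.comp h).congr' (hf.mono fun _ ht => Real.exp_log ht)

namespace SaddleFlow

variable {lam mu : ℝ} {α β χ : ℝ × ℝ × ℝ → ℝ} {K : ℝ × ℝ × ℝ → ℝ × ℝ × ℝ}
  {W : ℝ × ℝ × ℝ → ℝ → ℝ × ℝ × ℝ}

theorem exists_log_transition_bound (h : SaddleFlow lam mu α β χ K W) {c : ℝ → ℝ × ℝ}
    (hcI : ∀ᶠ t in atTop, c t ∈ Ioo (0 : ℝ) 1 ×ˢ Ioo (0 : ℝ) 1)
    (hc : Tendsto c atTop (𝓝 (0, 0))) :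
    ∃ M, ∀ᶠ t in atTop, |Real.log (transition W (c t)).1 - lam * Real.log (c t).2| ≤ M ∧
      |Real.log (transition W (c t)).2 - (Real.log (c t).1 + mu * Real.log (c t).2)| ≤ M := by
  obtain ⟨M, hM⟩ := h.exists_log_bound
  have hcos : Tendsto (fun t => Real.log (fencePhi (c t)).2.1) atTop (𝓝 0) := by
    have : ContinuousAt (fun q : ℝ × ℝ => Real.log (fencePhi q).2.1) (0, 0) := by
      simp only [fencePhi]
      refine ContinuousAt.log (by fun_prop) (by simp)
    simpa [fencePhi, Function.comp_def] using this.tendsto.comp hc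
  refine ⟨M + 1, ?_⟩
  filter_upwards [hcI, hcos.eventually (Metric.ball_mem_nhds 0 one_pos)] with t ht h1
  obtain ⟨hx, hy, hz⟩ := fencePhi_pos ht
  obtain ⟨h2, h3⟩ := hM _ (fencePhi_mem_Bcyl ht) hx hy hz
  rw [Real.dist_eq, sub_zero] at h1
  have h4 := abs_log_fencePhi_sub_le ht
  change |Real.log (transition W (c t)).1 - (_ + lam * Real.log (c t).2)| ≤ M at h2
  change |Real.log (transition W (c t)).2 - (_ + mu * Real.log (c t).2)| ≤ M at h3
  simp only [abs_le, abs_lt] at *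
  constructor <;> constructor <;> linarith [h1.1, h1.2, h2.1, h2.2, h3.1, h3.2, h4.1, h4.2]

theorem tendsto_transition (h : SaddleFlow lam mu α β χ K W) (hlam : 0 < lam) (hmu : 0 < mu)
    {c : ℝ → ℝ × ℝ} (hcI : ∀ᶠ t in atTop, c t ∈ Ioo (0 : ℝ) 1 ×ˢ Ioo (0 : ℝ) 1)
    (hc : Tendsto c atTop (𝓝 (0, 0))) :
    Tendsto (fun t => transition W (c t)) atTop (𝓝 (0, 0)) := by
  obtain ⟨M, hM⟩ := h.exists_log_transition_bound hcI hc
  have hlog : Tendsto (fun t => Real.log (c t).2) atTop atBot :=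
    Real.tendsto_log_nhdsGT_zero.comp (tendsto_nhdsWithin_iff.mpr
      ⟨(continuous_snd.tendsto _).comp hc, hcI.mono fun t ht => ht.2.1⟩)
  refine Tendsto.prodMk_nhds
    (tendsto_zero_of_log (hcI.mono fun t ht => (h.transition_pos ht).1) ?_)
    (tendsto_zero_of_log (hcI.mono fun t ht => (h.transition_pos ht).2) ?_)
  · refine tendsto_atBot_mono' _ ?_
      (tendsto_atBot_add_const_right _ M (hlog.const_mul_atBot hlam))
    filter_upwards [hM] with t ht
    change Real.log (transition W (c t)).1 ≤ _
    linarith [(abs_le.mp ht.1).2]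
  · refine tendsto_atBot_mono' _ ?_
      (tendsto_atBot_add_const_right _ M (hlog.const_mul_atBot hmu))
    filter_upwards [hM, hcI] with t ht hI
    change Real.log (transition W (c t)).2 ≤ _
    linarith [(abs_le.mp ht.2).2, Real.log_nonpos hI.1.1.le hI.1.2.le]

theorem curveHasWeight_transition (h : SaddleFlow lam mu α β χ K W) (hlam : 0 < lam)
    (hmu : 0 < mu) {ρ : ℝ} (hρ : 0 < ρ)
    {c : ℝ → ℝ × ℝ} (hcI : ∀ᶠ t in atTop, c t ∈ Ioo (0 : ℝ) 1 ×ˢ Ioo (0 : ℝ) 1)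
    (hc : Tendsto c atTop (𝓝 (0, 0))) (hw : CurveHasWeight c ρ) :
    CurveHasWeight (fun t => transition W (c t)) ((1 + mu * ρ) / (lam * ρ)) := by
  obtain ⟨M, hM⟩ := h.exists_log_transition_bound hcI hc
  obtain ⟨N, hN⟩ := hw.exists_abs_log_sub_le (hcI.mono fun t ht => ⟨ht.1.1, ht.2.1⟩)
  set σ := (1 + mu * ρ) / (lam * ρ) with hσ
  have hσ0 : 0 < σ := by positivity
  refine curveHasWeight_of_eventually (R := M + σ * M + N / ρ) ?_
  filter_upwards [hcI, hM, hN] with t ht ⟨hu, hv⟩ hn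
  refine ⟨(h.transition_pos ht).1, (h.transition_pos ht).2, ?_⟩
  generalize Real.log (transition W (c t)).1 = lu at *
  generalize Real.log (transition W (c t)).2 = lv at *
  generalize Real.log (c t).1 = l₁ at *
  generalize Real.log (c t).2 = l₂ at *
  have hid : lv - σ * lu
      = (lv - (l₁ + mu * l₂)) - σ * (lu - lam * l₂) - (l₂ - ρ * l₁) / ρ := by
    rw [hσ]; field_simp; ring
  rw [hid]
  refine (abs_sub _ _).trans (add_le_add ((abs_sub _ _).trans (add_le_add hv ?_)) ?_)
  · rw [abs_mul, abs_of_pos hσ0]; gcongr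
  · rw [abs_div, abs_of_pos hρ]; gcongr

end SaddleFlow
end Asymptotics

section Orbits

open Topology

/-- The scalar autonomous equation `ψ' = G(ψ)` with positive bounded right-hand side is solved by
an order isomorphism. -/
theorem exists_orderIso_hasDerivAt {G : ℝ → ℝ} (hG : Continuous G) (hpos : ∀ s, 0 < G s) {M : ℝ}
    (hM : ∀ s, G s ≤ M) : ∃ ψ : ℝ ≃o ℝ, ψ 0 = 0 ∧ ∀ τ, HasDerivAt ψ (G (ψ τ)) τ := by
  have hM0 : 0 < M := (hpos 0).trans_le (hM 0)
  have hGi : Continuous fun s => (G s)⁻¹ := hG.inv₀ fun s => (hpos s).ne'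
  let T : ℝ → ℝ := fun s => ∫ r in (0 : ℝ)..s, (G r)⁻¹
  have hT0 : T 0 = 0 := intervalIntegral.integral_same
  have hT : ∀ s, HasDerivAt T (G s)⁻¹ s := fun s =>
    intervalIntegral.integral_hasDerivAt_right (hGi.intervalIntegrable _ _)
      (hGi.stronglyMeasurableAtFilter _ _) hGi.continuousAt
  have hmono : StrictMono T := strictMono_of_deriv_pos fun s => by
    rw [(hT s).deriv]
    exact inv_pos.mpr (hpos s)
  have hlow : Monotone fun s => T s - M⁻¹ * s := by
    have hd : ∀ s, HasDerivAt (fun s => T s - M⁻¹ * s) ((G s)⁻¹ - M⁻¹ * 1) s := fun s =>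
      (hT s).fun_sub ((hasDerivAt_id s).const_mul _)
    refine monotone_of_deriv_nonneg (fun s => (hd s).differentiableAt) fun s => ?_
    rw [(hd s).deriv, mul_one, sub_nonneg]
    exact inv_anti₀ (hpos s) (hM s)
  have hsurj : Function.Surjective T := by
    refine (continuous_iff_continuousAt.mpr fun s => (hT s).continuousAt).surjective
      (tendsto_atTop_mono' _ ?_ (tendsto_id.const_mul_atTop (inv_pos.mpr hM0)))
      (tendsto_atBot_mono' _ ?_ (tendsto_id.const_mul_atBot (inv_pos.mpr hM0)))
    · filter_upwards [eventually_ge_atTop 0] with s hs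
      have := hlow hs
      simp only [hT0, mul_zero, sub_zero] at this
      exact sub_nonneg.mp this
    · filter_upwards [eventually_le_atBot 0] with s hs
      have := hlow hs
      simp only [hT0, mul_zero, sub_zero] at this
      exact sub_nonpos.mp this
  let e := hmono.orderIsoOfSurjective T hsurj
  have he : ∀ s, T (e.symm s) = s := fun s => e.apply_symm_apply s
  refine ⟨e.symm, ?_, fun τ => ?_⟩
  · rw [OrderIso.symm_apply_eq]
    exact hT0.symm
  · simpa using HasDerivAt.of_local_left_inverse e.symm.continuous.continuousAt (hT (e.symm τ))
      (inv_pos.mpr (hpos _)).ne' (Eventually.of_forall he)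

namespace SaddleFlow

variable {lam mu : ℝ} {α β χ : ℝ × ℝ × ℝ → ℝ} {K : ℝ × ℝ × ℝ → ℝ × ℝ × ℝ}
  {W : ℝ × ℝ × ℝ → ℝ → ℝ × ℝ × ℝ} {g : ℝ × ℝ × ℝ → ℝ} {γ : ℝ → ℝ × ℝ × ℝ} {s₀ s₁ : ℝ}

theorem hasDerivAt_fst_of_reparam (h : SaddleFlow lam mu α β χ K W) {τ : ℝ}
    (hB : γ τ ∈ Bcyl) (hγ : HasDerivAt γ (g (γ τ) • K (γ τ)) τ) :
    HasDerivAt (fun τ => (γ τ).1) (g (γ τ) * (γ τ).1) τ := by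
  have : HasDerivAt (fun τ => (γ τ).1) (g (γ τ) • K (γ τ)).1 τ := hγ.fst
  simpa [h.field_eq, h.cutoff_eq_one _ hB] using this

theorem monotoneOn_fst (h : SaddleFlow lam mu α β χ K W) (hg0 : ∀ p ∈ Bcyl, 0 < g p)
    (hB : ∀ τ ∈ Icc s₀ s₁, γ τ ∈ Bcyl)
    (hγ : ∀ τ ∈ Icc s₀ s₁, HasDerivAt γ (g (γ τ) • K (γ τ)) τ) :
    MonotoneOn (fun τ => (γ τ).1) (Icc s₀ s₁) := by
  have hd := fun τ hτ => h.hasDerivAt_fst_of_reparam (hB τ hτ) (hγ τ hτ)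
  refine monotoneOn_of_deriv_nonneg (convex_Icc _ _)
    (fun τ hτ => (hd τ hτ).continuousAt.continuousWithinAt)
    (fun τ hτ => (hd τ (interior_subset hτ)).differentiableAt.differentiableWithinAt)
    fun τ hτ => ?_
  rw [(hd τ (interior_subset hτ)).deriv]
  have := hB τ (interior_subset hτ)
  exact mul_nonneg (hg0 _ this).le this.1

/-- Integral curves of a positive multiple of `K` are reparametrized by the first coordinate. -/
theorem eq_flow_of_reparam (h : SaddleFlow lam mu α β χ K W) (hg : ContinuousOn g Bcyl)
    (hg0 : ∀ p ∈ Bcyl, 0 < g p) (hB : ∀ τ ∈ Icc s₀ s₁, γ τ ∈ Bcyl)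
    (hγ : ∀ τ ∈ Icc s₀ s₁, HasDerivAt γ (g (γ τ) • K (γ τ)) τ) (hx : 0 < (γ s₀).1) {τ : ℝ}
    (hτ : τ ∈ Icc s₀ s₁) : γ τ = W (γ s₀) (Real.log (γ τ).1 - Real.log (γ s₀).1) := by
  obtain ⟨C, hC⟩ := h.lipschitz
  obtain ⟨M, hM⟩ := isCompact_Bcyl.exists_bound_of_continuousOn hg
  have hs₀ : s₀ ∈ Icc s₀ s₁ := ⟨le_rfl, hτ.1.trans hτ.2⟩
  have hpos : ∀ τ ∈ Icc s₀ s₁, 0 < (γ τ).1 := fun τ hτ =>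
    hx.trans_le (h.monotoneOn_fst hg0 hB hγ hs₀ hτ hτ.1)
  have hψ : ∀ τ ∈ Icc s₀ s₁, HasDerivAt (fun τ => Real.log (γ τ).1 - Real.log (γ s₀).1)
      (g (γ τ)) τ := fun τ hτ => by
    refine (((h.hasDerivAt_fst_of_reparam (hB τ hτ) (hγ τ hτ)).log (hpos τ hτ).ne').sub_const
      _).congr_deriv ?_
    exact mul_div_cancel_right₀ _ (hpos τ hτ).ne'
  have hδ : ∀ τ ∈ Icc s₀ s₁,
      HasDerivAt (fun τ => W (γ s₀) (Real.log (γ τ).1 - Real.log (γ s₀).1))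
        (g (γ τ) • K (W (γ s₀) (Real.log (γ τ).1 - Real.log (γ s₀).1))) τ := fun τ hτ =>
    ((h.isFlow (γ s₀)).2 _).scomp τ (hψ τ hτ)
  refine ODE_solution_unique_of_mem_Icc_right (v := fun τ q => g (γ τ) • K q) (s := fun _ => univ)
    (K := M.toNNReal * C) (fun t ht => ?_)
    (fun t ht => (hγ t ht).continuousAt.continuousWithinAt)
    (fun t ht => (hγ t (Ico_subset_Icc_self ht)).hasDerivWithinAt) (fun _ _ => mem_univ _)
    (fun t ht => (hδ t ht).continuousAt.continuousWithinAt)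
    (fun t ht => (hδ t (Ico_subset_Icc_self ht)).hasDerivWithinAt) (fun _ _ => mem_univ _)
    ?_ hτ
  · refine (LipschitzWith.of_dist_le_mul fun q r => ?_).lipschitzOnWith
    have h1 := hM _ (hB t (Ico_subset_Icc_self ht))
    have hM0 : 0 ≤ M := (norm_nonneg _).trans h1
    rw [dist_smul₀, NNReal.coe_mul, Real.coe_toNNReal _ hM0, mul_assoc]
    exact mul_le_mul h1 (hC.dist_le_mul q r) dist_nonneg hM0
  · simp [(h.isFlow _).1]

/-- A segment of a `K`-orbit in the cylinder is a segment of an orbit of a positive multiple. -/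
theorem exists_reparam (h : SaddleFlow lam mu α β χ K W) (hg : ContinuousOn g Bcyl)
    (hg0 : ∀ p ∈ Bcyl, 0 < g p) {p : ℝ × ℝ × ℝ} {L : ℝ} (hL : 0 ≤ L)
    (hB : ∀ s ∈ Icc 0 L, W p s ∈ Bcyl) :
    ∃ (T : ℝ) (γ : ℝ → ℝ × ℝ × ℝ), 0 ≤ T ∧ γ 0 = p ∧ γ T = W p L ∧ ∀ τ ∈ Icc 0 T,
      γ τ ∈ Bcyl ∧ HasDerivAt γ (g (γ τ) • K (γ τ)) τ := by
  obtain ⟨M, hM⟩ := isCompact_Bcyl.exists_bound_of_continuousOn hg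
  have hmem : ∀ s, W p (projIcc 0 L hL s) ∈ Bcyl := fun s => hB _ (projIcc 0 L hL s).2
  obtain ⟨ψ, hψ0, hψ⟩ := exists_orderIso_hasDerivAt (G := fun s => g (W p (projIcc 0 L hL s)))
    (hg.comp_continuous ((h.isFlow.continuous p).comp
      (continuous_subtype_val.comp continuous_projIcc)) hmem)
    (fun s => hg0 _ (hmem s)) (fun s => (le_abs_self _).trans (hM _ (hmem s)))
  have hψs : ψ.symm 0 = 0 := by rw [OrderIso.symm_apply_eq, hψ0]
  refine ⟨ψ.symm L, fun τ => W p (ψ τ), ?_, ?_, ?_, fun τ hτ => ?_⟩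
  · rw [← hψs]
    exact ψ.symm.monotone hL
  · simp [hψ0, (h.isFlow p).1]
  · simp
  · have h1 : ψ τ ∈ Icc 0 L :=
      ⟨hψ0 ▸ ψ.monotone hτ.1, by simpa using ψ.monotone hτ.2⟩
    refine ⟨hB _ h1, ?_⟩
    have h2 := hψ τ
    simp only [projIcc_of_mem hL h1] at h2
    exact ((h.isFlow p).2 _).scomp τ h2

theorem setOf_phiX_mem_saturation (h : SaddleFlow lam mu α β χ K W) (hg : ContinuousOn g Bcyl)
    (hg0 : ∀ p ∈ Bcyl, 0 < g p) {ξ : ℝ × ℝ × ℝ → ℝ × ℝ × ℝ}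
    (hξ : ∀ p ∈ Bcyl, ξ p = g p • K p) {D : Set (ℝ × ℝ)}
    (hD : D ⊆ Ioo (0 : ℝ) 1 ×ˢ Ioo (0 : ℝ) 1) :
    {q : ℝ × ℝ | 0 < q.1 ∧ 0 < q.2 ∧ phiX q ∈ Saturation ξ (fencePhi '' D)}
      = transition W '' D := by
  ext q
  constructor
  · rintro ⟨-, -, s₀, s₁, hs, γ, hB, hγ, ⟨s, hsI, hsq⟩, hA⟩
    have hγ' : ∀ τ ∈ Icc s₀ s₁, HasDerivAt γ (g (γ τ) • K (γ τ)) τ := fun τ hτ => by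
      rw [← hξ _ (hB τ hτ)]
      exact hγ τ hτ
    have hs1 : (γ s).1 = 1 := by rw [hsq]; rfl
    rcases hA with ⟨r, hr, hrγ⟩ | ⟨r, hr, hrγ⟩
    · refine ⟨r, hr, ?_⟩
      have hx := (fencePhi_pos (hD hr)).1
      have := h.eq_flow_of_reparam hg hg0 hB hγ' (hrγ ▸ hx) hsI
      rw [hs1, hsq, ← hrγ, Real.log_one, zero_sub] at this
      exact (congrArg Prod.snd this).symm
    · have := h.monotoneOn_fst hg0 hB hγ' hsI ⟨hs, le_rfl⟩ hsI.2
      simp only [hs1, ← hrγ] at this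
      exact absurd this (not_le.mpr (hD hr).2.2)
  · rintro ⟨r, hr, rfl⟩
    have hrI := hD hr
    have hL : 0 ≤ -Real.log r.2 := by linarith [Real.log_nonpos hrI.2.1.le hrI.2.2.le]
    obtain ⟨T, γ, hT, h0, h1, hγ⟩ :=
      h.exists_reparam hg hg0 hL fun s hs => h.mem_Bcyl_of_fencePhi hrI hs
    refine ⟨(h.transition_pos hrI).1, (h.transition_pos hrI).2, 0, T, hT, γ,
      fun τ hτ => (hγ τ hτ).1, fun τ hτ => ?_, ⟨T, ⟨hT, le_rfl⟩, ?_⟩, Or.inl ⟨r, hr, h0.symm⟩⟩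
    · rw [hξ _ (hγ τ hτ).1]
      exact (hγ τ hτ).2
    · rw [h1, h.phiX_transition hrI]

end SaddleFlow
end Orbits

/-- inverse weight transition through a three-dimensional saddle,
first case: if `D' ⊆ (0,1) × (0,1)` has weight `ρ'' > 0` and `S'_y` is the
saturation of `Φ(D')` by the `ξ`-flow in `B`, then
`φₓ⁻¹(S'_y) = {(u,v) ∈ ℝ²_{>0} : (1,u,v) ∈ S'_y}` has weight
`(1 + μρ'')/(λρ'')`. -/
theorem inverse_weight_transition_first_case
    (lam mu : ℝ) (hlam : 0 < lam) (hmu : 0 < mu)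
    (V : Set (ℝ × ℝ × ℝ)) (hVopen : IsOpen V) (hBV : Bcyl ⊆ V)
    (a b c : ℝ × ℝ × ℝ → ℝ)
    (ha : AnalyticOnNhd ℝ a V) (hb : AnalyticOnNhd ℝ b V) (hc : AnalyticOnNhd ℝ c V)
    (ha0 : a (0, 0, 0) = 0) (hb0 : b (0, 0, 0) = 0) (hc0 : c (0, 0, 0) = 0)
    (ξ : ℝ × ℝ × ℝ → ℝ × ℝ × ℝ)
    (hξ : ∀ p : ℝ × ℝ × ℝ,
      ξ p = ((1 + a p) * p.1, (-lam + b p) * p.2.1, (-mu + c p) * p.2.2))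
    (htrans1 : ∀ p ∈ Bcyl, 0 < 1 + a p)
    (htrans2 : ∀ p ∈ Bcyl, (p.2.1, p.2.2) ≠ ((0 : ℝ), (0 : ℝ)) →
      (-lam + b p) * p.2.1 ^ 2 + (-mu + c p) * p.2.2 ^ 2 < 0)
    (D' : Set (ℝ × ℝ)) (hD' : D' ⊆ Set.Ioo (0 : ℝ) 1 ×ˢ Set.Ioo (0 : ℝ) 1)
    (ρ'' : ℝ) (hρ'' : 0 < ρ'') (hw : SetHasWeight D' ρ'')
    (S'y : Set (ℝ × ℝ × ℝ)) (hS'y : S'y = Saturation ξ (fencePhi '' D')) :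
    SetHasWeight {q : ℝ × ℝ | 0 < q.1 ∧ 0 < q.2 ∧ phiX q ∈ S'y}
      ((1 + mu * ρ'') / (lam * ρ'')) := by
  obtain ⟨α, β, χ, K, W, h, hK⟩ :=
    exists_saddleFlow hlam hmu hVopen hBV ha hb hc ha0 hb0 hc0 htrans1 htrans2
  obtain ⟨d, ⟨hd_an, hd_pos, hd_ne, hd_lim⟩, hdw, rfl⟩ := hw
  have hg : ContinuousOn (fun p => 1 + a p) Bcyl :=
    continuousOn_const.add (ha.continuousOn.mono hBV)
  have hdI : ∀ t ∈ Ici (1 : ℝ), d t ∈ Ioo (0 : ℝ) 1 ×ˢ Ioo (0 : ℝ) 1 := fun t ht =>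
    hD' (mem_image_of_mem d ht)
  have hdI' : ∀ᶠ t in atTop, d t ∈ Ioo (0 : ℝ) 1 ×ˢ Ioo (0 : ℝ) 1 :=
    (eventually_ge_atTop 1).mono hdI
  rw [hS'y, h.setOf_phiX_mem_saturation hg htrans1 (fun p hp => (hξ p).trans (hK p hp)) hD',
    image_image]
  refine ⟨fun t => transition W (d t), ⟨fun t ht => ?_, fun t ht => h.transition_pos (hdI t ht),
    fun t ht => ?_, h.tendsto_transition hlam hmu hdI' hd_lim⟩,
    h.curveHasWeight_transition hlam hmu hρ'' hdI' hd_lim hdw, rfl⟩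
  · exact (h.analyticAt_transition (hdI t ht)).comp (hd_an t ht)
  · refine h.deriv_transition_ne_zero ?_ (hd_an t ht.le).differentiableAt (hd_ne t ht)
    filter_upwards [Ioi_mem_nhds ht] with s hs
    exact hdI s (mem_Ioi.mp hs).le
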